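/- Let p ∈ (0,1) and α := 1/p − 1. Then Λ_{nα}(ℝⁿ) is continuously embedded into L^∞(ℝⁿ) ∩ L_loc^{Φ_p}(ℝⁿ): for every g ∈ Λ_{nα}(ℝⁿ), ‖g‖_{L^∞} + ‖g‖_{L_loc^{Φ_p}} ≲ ‖g‖_{Λ_{nα}}. -/

import Mathlib

open MeasureTheory

/-- The Orlicz function `Φ_p(τ) = τ / (1 + τ^(1-p))`. -/
noncomputable def PhiP (p τ : ℝ) : ℝ := τ / (1 + τ ^ (1 - p))

/-- The Luxemburg quasi-norm with respect to `Φ_p` on `ℝⁿ`. -/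
noncomputable def luxNorm (n : ℕ) (p : ℝ) (f : EuclideanSpace ℝ (Fin n) → ℝ) : ℝ :=
  sInf {lam : ℝ | 0 < lam ∧ ∫ x, PhiP p (|f x| / lam) ≤ 1}

/-- Evaluation of a real polynomial in `n` variables at a point of `ℝⁿ`. -/
noncomputable def mvEval {n : ℕ} (x : EuclideanSpace ℝ (Fin n))
    (P : MvPolynomial (Fin n) ℝ) : ℝ :=
  MvPolynomial.eval (fun i => x i) P

/-- Iterated difference operator: `D_h^k f`. -/
def iterDiff {n : ℕ} (h : EuclideanSpace ℝ (Fin n)) (f : EuclideanSpace ℝ (Fin n) → ℝ) :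
    ℕ → EuclideanSpace ℝ (Fin n) → ℝ
  | 0 => f
  | k + 1 => fun x => iterDiff h f k (x + h) - iterDiff h f k x

/-- `q` is (evaluation of) a polynomial of total degree at most `d`. -/
def IsPolyFun {n : ℕ} (d : ℕ) (q : (Fin n → ℝ) → ℝ) : Prop :=
  ∃ Q : MvPolynomial (Fin n) ℝ, Q.totalDegree ≤ d ∧ ∀ x, q x = MvPolynomial.eval x Q

namespace IsPolyFun

open MvPolynomial

variable {n d e : ℕ} {q q' : (Fin n → ℝ) → ℝ}

theorem mono (h : IsPolyFun d q) (hde : d ≤ e) : IsPolyFun e q := by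
  obtain ⟨Q, hQ, hq⟩ := h
  exact ⟨Q, hQ.trans hde, hq⟩

theorem const (c : ℝ) : IsPolyFun d (fun _ : Fin n → ℝ => c) :=
  ⟨C c, by simp, by simp⟩

theorem coord (i : Fin n) : IsPolyFun 1 (fun x : Fin n → ℝ => x i) :=
  ⟨X i, by simp, by simp⟩

theorem add (h : IsPolyFun d q) (h' : IsPolyFun d q') : IsPolyFun d (fun x => q x + q' x) := by
  obtain ⟨Q, hQ, hq⟩ := h
  obtain ⟨Q', hQ', hq'⟩ := h'
  exact ⟨Q + Q', (totalDegree_add _ _).trans (max_le hQ hQ'), fun x => by simp [hq, hq']⟩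

theorem mul (h : IsPolyFun d q) (h' : IsPolyFun e q') :
    IsPolyFun (d + e) (fun x => q x * q' x) := by
  obtain ⟨Q, hQ, hq⟩ := h
  obtain ⟨Q', hQ', hq'⟩ := h'
  exact ⟨Q * Q', (totalDegree_mul _ _).trans (add_le_add hQ hQ'), fun x => by simp [hq, hq']⟩

theorem const_mul (c : ℝ) (h : IsPolyFun d q) : IsPolyFun d (fun x => c * q x) := by
  simpa using (const (d := 0) c).mul h

theorem sub (h : IsPolyFun d q) (h' : IsPolyFun d q') : IsPolyFun d (fun x => q x - q' x) := by
  simpa [sub_eq_add_neg] using h.add (h'.const_mul (-1))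

theorem pow (h : IsPolyFun 1 q) (m : ℕ) : IsPolyFun m (fun x => q x ^ m) := by
  induction m with
  | zero => simpa using const (n := n) (d := 0) 1
  | succ m ih => simpa only [pow_succ] using ih.mul h

theorem sum {ι : Type*} (s : Finset ι) {f : ι → (Fin n → ℝ) → ℝ}
    (h : ∀ i ∈ s, IsPolyFun d (f i)) : IsPolyFun d (fun x => ∑ i ∈ s, f i x) := by
  classical
  induction s using Finset.induction_on with
  | empty => simpa using const (n := n) (d := d) 0
  | insert a s ha ih =>
    simp only [Finset.sum_insert ha]
    exact (h a (by simp)).add (ih fun i hi => h i (by simp [hi]))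

theorem prod {ι : Type*} (s : Finset ι) {f : ι → (Fin n → ℝ) → ℝ} {m : ι → ℕ}
    (h : ∀ i ∈ s, IsPolyFun (m i) (f i)) :
    IsPolyFun (∑ i ∈ s, m i) (fun x => ∏ i ∈ s, f i x) := by
  classical
  induction s using Finset.induction_on with
  | empty => simpa using const (n := n) (d := 0) 1
  | insert a s ha ih =>
    simp only [Finset.sum_insert ha, Finset.prod_insert ha]
    exact (h a (by simp)).mul (ih fun i hi => h i (by simp [hi]))

theorem sum_le_of_mem_support {Q : MvPolynomial (Fin n) ℝ} (hQ : Q.totalDegree ≤ d)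
    {m : Fin n →₀ ℕ} (hm : m ∈ Q.support) : ∑ i, m i ≤ d := by
  have := (le_totalDegree hm).trans hQ
  rwa [Finsupp.sum_fintype _ _ (fun _ => rfl)] at this

/-- Composition of a polynomial with affine coordinate functions. -/
theorem comp (h : IsPolyFun d q) {φ : (Fin n → ℝ) → Fin n → ℝ}
    (hφ : ∀ i, IsPolyFun 1 (fun x => φ x i)) : IsPolyFun d (fun x => q (φ x)) := by
  obtain ⟨Q, hQ, hq⟩ := h
  simp only [hq, eval_eq']
  exact sum _ fun m hm =>
    ((prod Finset.univ fun i _ => (hφ i).pow (m i)).mono (sum_le_of_mem_support hQ hm)).const_mul _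

theorem continuous (h : IsPolyFun d q) : Continuous q := by
  obtain ⟨Q, -, hq⟩ := h
  rw [funext hq]
  exact MvPolynomial.continuous_eval Q

theorem update_zero (h : IsPolyFun d q) (i : Fin n) :
    IsPolyFun d (fun x => q (Function.update x i 0)) := by
  refine h.comp fun j => ?_
  by_cases hj : j = i
  · subst hj
    simpa using const 0
  · simpa [hj] using coord j

/-- Integration in one coordinate. -/
theorem integral_update (h : IsPolyFun d q) (i : Fin n) :
    IsPolyFun (d + 1) (fun x => ∫ t in (0 : ℝ)..x i, q (Function.update x i t)) := by
  obtain ⟨Q, hQ, hq⟩ := h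
  have key : ∀ x : Fin n → ℝ, ∫ t in (0 : ℝ)..x i, q (Function.update x i t) =
      ∑ m ∈ Q.support, (Q.coeff m / (m i + 1)) * ((∏ j, x j ^ m j) * x i) := by
    intro x
    have hprod : ∀ (m : Fin n →₀ ℕ) (t : ℝ), ∏ j, Function.update x i t j ^ m j =
        t ^ m i * ∏ j ∈ Finset.univ.erase i, x j ^ m j := by
      intro m t
      rw [← Finset.mul_prod_erase _ _ (Finset.mem_univ i)]
      congr 1
      · simp
      · refine Finset.prod_congr rfl fun j hj => ?_
        rw [Function.update_of_ne (Finset.ne_of_mem_erase hj)]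
    simp only [hq, eval_eq', hprod]
    rw [intervalIntegral.integral_finsetSum
      fun m _ => Continuous.intervalIntegrable (by fun_prop) _ _]
    refine Finset.sum_congr rfl fun m _ => ?_
    rw [intervalIntegral.integral_const_mul, intervalIntegral.integral_mul_const, integral_pow,
      ← Finset.mul_prod_erase _ _ (Finset.mem_univ i)]
    have : (m i : ℝ) + 1 ≠ 0 := by positivity
    field_simp
    ring
  simp only [key]
  exact sum _ fun m hm => ((((prod Finset.univ fun j _ => (coord j).pow (m j)).mono
    (sum_le_of_mem_support hQ hm)).mul (coord i))).const_mul _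

end IsPolyFun

/-- The signed mixed difference of order `k` with steps `h 0, …, h (k - 1)`. -/
def mixedDiff {E : Type*} [AddCommGroup E] (k : ℕ) (h : ℕ → E) (f : E → ℝ) (x : E) : ℝ :=
  ∑ S ∈ (Finset.range k).powerset, (-1) ^ S.card * f (x + ∑ j ∈ S, h j)

theorem mixedDiff_succ {E : Type*} [AddCommGroup E] (k : ℕ) (h : ℕ → E) (f : E → ℝ) (x : E) :
    mixedDiff (k + 1) h f x = -mixedDiff k h (fun y => f (y + h k) - f y) x := by
  unfold mixedDiff
  rw [Finset.range_add_one, Finset.sum_powerset_insert Finset.notMem_range_self,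
    ← Finset.sum_neg_distrib, ← Finset.sum_add_distrib]
  refine Finset.sum_congr rfl fun S hS => ?_
  have hk : k ∉ S := fun hk => Finset.notMem_range_self (Finset.mem_powerset.1 hS hk)
  rw [Finset.card_insert_of_notMem hk, Finset.sum_insert hk,
    show x + (h k + ∑ j ∈ S, h j) = x + ∑ j ∈ S, h j + h k by abel]
  ring

theorem mixedDiff_congr {E : Type*} [AddCommGroup E] {k : ℕ} {h h' : ℕ → E}
    (hh : ∀ j < k, h j = h' j) (f : E → ℝ) (x : E) :
    mixedDiff k h f x = mixedDiff k h' f x := by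
  refine Finset.sum_congr rfl fun S hS => ?_
  rw [Finset.sum_congr rfl fun j hj => hh j (Finset.mem_range.1 (Finset.mem_powerset.1 hS hj))]

theorem sum_powerset_neg_one_pow_eq_zero {ι : Type*} [DecidableEq ι] {s : Finset ι} {a : ι}
    (ha : a ∈ s) (F : Finset ι → ℝ) (hF : ∀ t ⊆ s.erase a, F (insert a t) = F t) :
    ∑ S ∈ s.powerset, (-1) ^ S.card * F S = 0 := by
  rw [← Finset.insert_erase ha, Finset.sum_powerset_insert (Finset.notMem_erase a s),
    ← Finset.sum_add_distrib]
  refine Finset.sum_eq_zero fun t ht => ?_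
  have ht' := Finset.mem_powerset.1 ht
  rw [hF t ht', Finset.card_insert_of_notMem fun h => Finset.notMem_erase a s (ht' h)]
  ring

theorem iterDiff_eq_sum {n : ℕ} (h : EuclideanSpace ℝ (Fin n))
    (f : EuclideanSpace ℝ (Fin n) → ℝ) (k : ℕ) (x : EuclideanSpace ℝ (Fin n)) :
    iterDiff h f k x =
      ∑ i ∈ Finset.range (k + 1), (-1) ^ (k - i) * (k.choose i : ℝ) * f (x + (i : ℝ) • h) := by
  have hk : ∀ k, iterDiff h f k = (fwdDiff h)^[k] f := by
    intro k
    induction k with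
    | zero => rfl
    | succ k ih =>
      rw [Function.iterate_succ_apply', ← ih]
      rfl
  rw [hk, fwdDiff_iter_eq_sum_shift]
  refine Finset.sum_congr rfl fun i _ => ?_
  rw [zsmul_eq_mul, Nat.cast_smul_eq_nsmul]
  push_cast
  rfl

/-- Mixed differences are combinations of pure differences of the same order. -/
theorem mixedDiff_eq_sum_iterDiff {n : ℕ} (k : ℕ) (h : ℕ → EuclideanSpace ℝ (Fin n))
    (f : EuclideanSpace ℝ (Fin n) → ℝ) (x : EuclideanSpace ℝ (Fin n)) :
    (-1) ^ k * mixedDiff k h f x = ∑ S ∈ (Finset.range k).powerset, (-1) ^ S.card *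
      iterDiff (-∑ j ∈ S, ((j : ℝ) + 1)⁻¹ • h j) f k (x + ∑ j ∈ S, h j) := by
  simp only [iterDiff_eq_sum, Finset.mul_sum]
  rw [Finset.sum_comm, Finset.sum_range_succ']
  have hz : ∀ i ∈ Finset.range k, ∑ S ∈ (Finset.range k).powerset, (-1 : ℝ) ^ S.card *
      ((-1) ^ (k - (i + 1)) * (k.choose (i + 1) : ℝ) * f (x + ∑ j ∈ S, h j +
        ((i + 1 : ℕ) : ℝ) • -∑ j ∈ S, ((j : ℝ) + 1)⁻¹ • h j)) = 0 := by
    intro i hi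
    refine sum_powerset_neg_one_pow_eq_zero hi _ fun t ht => ?_
    have hit : i ∉ t := fun hit => Finset.notMem_erase i _ (ht hit)
    have hi0 : (i : ℝ) + 1 ≠ 0 := by positivity
    rw [Finset.sum_insert hit, Finset.sum_insert hit, neg_add, smul_add, smul_neg, smul_smul]
    push_cast
    rw [mul_inv_cancel₀ hi0, one_smul]
    congr 2
    abel
  rw [Finset.sum_eq_zero hz, zero_add, mixedDiff, Finset.mul_sum]
  refine Finset.sum_congr rfl fun S _ => ?_
  simp
  ring

theorem abs_mixedDiff_le {n k : ℕ} {f : EuclideanSpace ℝ (Fin n) → ℝ} {L β r : ℝ}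
    (hL : 0 ≤ L) (hβ : 0 ≤ β) (hr : 0 ≤ r)
    (hf : ∀ x h, h ≠ 0 → |iterDiff h f (k + 1) x| ≤ L * ‖h‖ ^ β)
    {h : ℕ → EuclideanSpace ℝ (Fin n)} (hh : ∀ j, ‖h j‖ ≤ r) (x : EuclideanSpace ℝ (Fin n)) :
    |mixedDiff (k + 1) h f x| ≤ 2 ^ (k + 1) * (L * (((k : ℝ) + 1) * r) ^ β) := by
  have h0 : |mixedDiff (k + 1) h f x| = |(-1) ^ (k + 1) * mixedDiff (k + 1) h f x| := by
    simp [abs_mul]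
  rw [h0, mixedDiff_eq_sum_iterDiff]
  refine (Finset.abs_sum_le_sum_abs _ _).trans ?_
  refine (Finset.sum_le_card_nsmul _ _ (L * (((k : ℝ) + 1) * r) ^ β) fun S hS => ?_).trans
    (by simp)
  rw [abs_mul, abs_pow, abs_neg, abs_one, one_pow, one_mul]
  set v := -∑ j ∈ S, ((j : ℝ) + 1)⁻¹ • h j with hv
  have hvr : ‖v‖ ≤ ((k : ℝ) + 1) * r := by
    rw [hv, norm_neg]
    calc ‖∑ j ∈ S, ((j : ℝ) + 1)⁻¹ • h j‖ ≤ ∑ j ∈ S, r := by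
          refine norm_sum_le_of_le _ fun j _ => ?_
          rw [norm_smul, Real.norm_of_nonneg (by positivity)]
          have : ((j : ℝ) + 1)⁻¹ ≤ 1 := inv_le_one_of_one_le₀ (by simp)
          calc ((j : ℝ) + 1)⁻¹ * ‖h j‖ ≤ 1 * r := by gcongr; exact hh j
            _ = r := one_mul r
      _ = S.card * r := by simp
      _ ≤ ((k : ℝ) + 1) * r := by
          gcongr
          have := Finset.card_le_card (Finset.mem_powerset.1 hS)
          rw [Finset.card_range] at this
          exact_mod_cast this
  by_cases hv0 : v = 0
  · have hz : ∀ y, iterDiff v f (k + 1) y = 0 := by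
      intro y
      simp [hv0, iterDiff]
    rw [hz, abs_zero]
    positivity
  · refine (hf _ v hv0).trans ?_
    gcongr

/-- The mixed differences of order `k` of `f` along coordinate steps of length at most one are
bounded by `ε`. -/
def MixedDiffBound {n : ℕ} (k : ℕ) (ε : ℝ) (f : (Fin n → ℝ) → ℝ) : Prop :=
  ∀ (i : ℕ → Fin n) (u : ℕ → ℝ), (∀ j, u j ∈ Set.Icc (0 : ℝ) 1) → ∀ x,
    |mixedDiff k (fun j => Pi.single (i j) (u j)) f x| ≤ ε

namespace MixedDiffBound

variable {n k : ℕ} {ε : ℝ} {f : (Fin n → ℝ) → ℝ}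

theorem diff (h : MixedDiffBound (k + 1) ε f) (i : Fin n) {u : ℝ} (hu : u ∈ Set.Icc (0 : ℝ) 1) :
    MixedDiffBound k ε (fun y => f (y + Pi.single i u) - f y) := by
  intro i' u' hu' x
  have := h (Function.update i' k i) (Function.update u' k u) (fun j => by
    by_cases hj : j = k
    · subst hj; simpa using hu
    · simpa [hj] using hu' j) x
  rw [mixedDiff_succ, abs_neg] at this
  simp only [Function.update_self] at this
  rw [mixedDiff_congr (h' := fun j => Pi.single (Function.update i' k i j)
    (Function.update u' k u j))]
  · exact this
  · intro j hj
    simp [hj.ne]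

theorem average (h : MixedDiffBound (k + 1) ε f) (hf : Continuous f) (i : Fin n) :
    MixedDiffBound k ε (fun y => ∫ u in (0 : ℝ)..1, (f (y + Pi.single i u) - f y)) := by
  intro i' u' hu' x
  have hc : mixedDiff k (fun j => Pi.single (i' j) (u' j))
      (fun y => ∫ u in (0 : ℝ)..1, (f (y + Pi.single i u) - f y)) x =
      ∫ u in (0 : ℝ)..1, mixedDiff k (fun j => Pi.single (i' j) (u' j))
        (fun y => f (y + Pi.single i u) - f y) x := by
    unfold mixedDiff
    have hs : Continuous fun u : ℝ => (Pi.single i u : Fin n → ℝ) :=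
      continuous_single (A := fun _ => ℝ) i
    rw [intervalIntegral.integral_finsetSum
      fun S _ => Continuous.intervalIntegrable (by fun_prop) _ _]
    simp only [intervalIntegral.integral_const_mul]
  rw [hc, ← Real.norm_eq_abs]
  refine (intervalIntegral.norm_integral_le_of_norm_le_const (C := ε) fun u hu => ?_).trans
    (by simp)
  rw [Set.uIoc_of_le zero_le_one] at hu
  exact h.diff i ⟨hu.1.le, hu.2⟩ i' u' hu' x

theorem abs_sub_le (h : MixedDiffBound 1 ε f) (i : Fin n) {u : ℝ} (hu : u ∈ Set.Icc (0 : ℝ) 1)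
    (x : Fin n → ℝ) : |f (x + Pi.single i u) - f x| ≤ ε := by
  simpa [mixedDiff] using h.diff i hu (fun _ => i) (fun _ => 0) (by simp) x

end MixedDiffBound

theorem update_eq_add_single {n : ℕ} (x : Fin n → ℝ) (i : Fin n) (t u : ℝ) :
    Function.update x i t + Pi.single i u = Function.update x i (t + u) := by
  ext j
  by_cases hj : j = i
  · subst hj; simp
  · simp [hj]

/-- Approximation in each coordinate separately gives approximation in all coordinates. -/
theorem exists_isPolyFun_of_coord {n d : ℕ} {δ : ℝ} {f : (Fin n → ℝ) → ℝ}
    (h : ∀ i, ∃ q, IsPolyFun d q ∧ ∀ x : Fin n → ℝ, (∀ j, |x j| ≤ 1) →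
      |f x - f (Function.update x i 0) - q x| ≤ δ) :
    ∃ q, IsPolyFun d q ∧ ∀ x : Fin n → ℝ, (∀ j, |x j| ≤ 1) → |f x - q x| ≤ n * δ := by
  classical
  choose q hq hqf using h
  have key : ∀ S : Finset (Fin n), ∃ Q, IsPolyFun d Q ∧ ∀ x : Fin n → ℝ, (∀ j, |x j| ≤ 1) →
      |f x - f (fun j => if j ∈ S then 0 else x j) - Q x| ≤ S.card * δ := by
    intro S
    induction S using Finset.induction_on with
    | empty => exact ⟨fun _ => 0, IsPolyFun.const 0, by simp⟩
    | insert i S hi ih =>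
      obtain ⟨Q, hQ, hQf⟩ := ih
      refine ⟨fun x => Q x + q i (fun j => if j ∈ S then 0 else x j),
        hQ.add ((hq i).comp fun j => ?_), fun x hx => ?_⟩
      · by_cases hj : j ∈ S
        · simpa [hj] using IsPolyFun.const 0
        · simpa [hj] using IsPolyFun.coord j
      · have h1 := hQf x hx
        have h2 := hqf i (fun j => if j ∈ S then 0 else x j) fun j => by
          by_cases hj : j ∈ S
          · simp [hj]
          · simpa [hj] using hx j
        have h3 : Function.update (fun j => if j ∈ S then 0 else x j) i 0 =
            fun j => if j ∈ insert i S then 0 else x j := by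
          ext j
          by_cases hj : j = i
          · subst hj; simp
          · simp [hj]
        rw [h3] at h2
        rw [Finset.card_insert_of_notMem hi]
        push_cast
        rw [abs_le] at *
        constructor <;> linarith [h1.1, h1.2, h2.1, h2.2]
  obtain ⟨Q, hQ, hQf⟩ := key Finset.univ
  refine ⟨fun x => f (fun _ => 0) + Q x, (IsPolyFun.const _).add hQ, fun x hx => ?_⟩
  have := hQf x hx
  simp only [Finset.mem_univ, if_true, Finset.card_univ, Fintype.card_fin] at this
  rwa [← sub_sub]

/-- A Whitney-type estimate: a continuous function with small mixed differences of order `k + 1`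
is close to a polynomial of degree at most `k` on the unit cube. -/
theorem exists_isPolyFun_of_mixedDiffBound (n k : ℕ) :
    ∃ C : ℝ, 0 ≤ C ∧ ∀ (f : (Fin n → ℝ) → ℝ) (ε : ℝ), Continuous f →
      MixedDiffBound (k + 1) ε f →
      ∃ q, IsPolyFun k q ∧ ∀ x : Fin n → ℝ, (∀ j, |x j| ≤ 1) → |f x - q x| ≤ C * ε := by
  induction k with
  | zero =>
    refine ⟨n, by positivity, fun f ε _ h => exists_isPolyFun_of_coord fun i =>
      ⟨fun _ => 0, IsPolyFun.const 0, fun x hx => ?_⟩⟩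
    rw [sub_zero]
    have hi := abs_le.1 (hx i)
    rcases le_total 0 (x i) with h0 | h0
    · simpa [update_eq_add_single] using h.abs_sub_le i ⟨h0, hi.2⟩ (Function.update x i 0)
    · have := h.abs_sub_le i (u := -x i) ⟨by linarith, by linarith⟩ (Function.update x i (x i))
      rw [update_eq_add_single, add_neg_cancel, Function.update_eq_self, abs_sub_comm] at this
      exact this
  | succ k ih =>
    obtain ⟨C, hC, H⟩ := ih
    refine ⟨n * (3 * C), by positivity, fun f ε hf h => ?_⟩
    simp only [mul_assoc]
    refine exists_isPolyFun_of_coord fun i => ?_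
    have hs : Continuous fun u : ℝ => (Pi.single i u : Fin n → ℝ) :=
      continuous_single (A := fun _ => ℝ) i
    have hG : Continuous fun y => ∫ u in (0 : ℝ)..1, (f (y + Pi.single i u) - f y) := by
      apply intervalIntegral.continuous_parametric_intervalIntegral_of_continuous'
      exact (hf.comp (continuous_fst.add (hs.comp continuous_snd))).sub (hf.comp continuous_fst)
    have hD : Continuous fun y => f (y + Pi.single i 1) - f y :=
      (hf.comp (continuous_id.add continuous_const)).sub hf
    obtain ⟨q₁, hq₁, hf₁⟩ := H _ ε hG (h.average hf i)
    obtain ⟨q₂, hq₂, hf₂⟩ := H _ ε hD (h.diff i (by simp))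
    refine ⟨fun x => q₁ (Function.update x i 0) - q₁ x +
      ∫ t in (0 : ℝ)..x i, q₂ (Function.update x i t),
      (((hq₁.update_zero i).sub hq₁).mono (Nat.le_succ k)).add (hq₂.integral_update i),
      fun x hx => ?_⟩
    have hcube : ∀ t : ℝ, |t| ≤ 1 → ∀ j, |Function.update x i t j| ≤ 1 := by
      intro t ht j
      by_cases hj : j = i
      · subst hj; simpa using ht
      · simpa [hj] using hx j
    have hupd : Continuous fun t : ℝ => Function.update x i t :=
      continuous_const.update i continuous_id
    have hφ : Continuous fun t : ℝ => f (Function.update x i t) := hf.comp hupd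
    set φ : ℝ → ℝ := fun t => f (Function.update x i t) with hφ_def
    have hint : ∀ a b : ℝ, IntervalIntegrable φ volume a b := fun a b => hφ.intervalIntegrable a b
    have havg : ∀ t : ℝ, ∫ u in (0 : ℝ)..1,
        (f (Function.update x i t + Pi.single i u) - f (Function.update x i t)) =
        (∫ u in t..(t + 1), φ u) - φ t := by
      intro t
      simp only [update_eq_add_single]
      rw [intervalIntegral.integral_sub (Continuous.intervalIntegrable (by fun_prop) _ _)
        (by simp)]
      have := intervalIntegral.integral_comp_add_left (a := 0) (b := 1) φ t
      simp only [add_zero] at this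
      rw [← this]
      simp [hφ_def]
    have h1 := hf₁ x hx
    have h2 := hf₁ (Function.update x i 0) (hcube 0 (by simp))
    rw [← Function.update_eq_self i x, havg (x i), Function.update_eq_self] at h1
    rw [havg 0, zero_add] at h2
    have h3 : |∫ t in (0 : ℝ)..x i, (φ (t + 1) - φ t - q₂ (Function.update x i t))| ≤ C * ε := by
      rw [← Real.norm_eq_abs]
      have hb : ∀ t ∈ Set.uIoc (0 : ℝ) (x i),
          ‖φ (t + 1) - φ t - q₂ (Function.update x i t)‖ ≤ C * ε := by
        intro t ht
        have ht1 : |t| ≤ 1 := by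
          have h' := abs_le.1 (hx i)
          rcases Set.mem_uIoc.1 ht with h'' | h'' <;> rw [abs_le] <;> constructor <;> linarith
        have := hf₂ (Function.update x i t) (hcube t ht1)
        rwa [update_eq_add_single] at this
      refine (intervalIntegral.norm_integral_le_of_norm_le_const hb).trans ?_
      rw [sub_zero]
      exact mul_le_of_le_one_right ((abs_nonneg _).trans h1) (hx i)
    have hφ1 : Continuous fun t : ℝ => φ (t + 1) := hφ.comp (by fun_prop)
    have hq₂c : Continuous fun t : ℝ => q₂ (Function.update x i t) := hq₂.continuous.comp hupd
    rw [intervalIntegral.integral_sub ((hφ1.intervalIntegrable _ _).sub (hint _ _))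
      (hq₂c.intervalIntegrable _ _),
      intervalIntegral.integral_sub (hφ1.intervalIntegrable _ _) (hint _ _),
      intervalIntegral.integral_comp_add_right, zero_add] at h3
    have h4 := intervalIntegral.integral_add_adjacent_intervals (hint 0 1) (hint 1 (x i + 1))
    have h5 := intervalIntegral.integral_add_adjacent_intervals (hint 0 (x i))
      (hint (x i) (x i + 1))
    have h6 : φ (x i) = f x := by simp [hφ_def]
    have h7 : φ 0 = f (Function.update x i 0) := rfl
    rw [h6] at h1
    rw [h7] at h2
    rw [abs_le] at *
    constructor <;> linarith [h1.1, h1.2, h2.1, h2.2, h3.1, h3.2]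

theorem exists_mvEval_approx (n s : ℕ) {β : ℝ} (hβ : 0 ≤ β) :
    ∃ C : ℝ, 0 ≤ C ∧ ∀ (g : EuclideanSpace ℝ (Fin n) → ℝ) (L : ℝ), Continuous g → 0 ≤ L →
      (∀ x h, h ≠ 0 → |iterDiff h g (s + 1) x| ≤ L * ‖h‖ ^ β) →
      ∀ (x₀ : EuclideanSpace ℝ (Fin n)) (r : ℝ), 0 < r →
        ∃ Q : MvPolynomial (Fin n) ℝ, Q.totalDegree ≤ s ∧
          ∀ x ∈ Metric.ball x₀ r, |g x - mvEval x Q| ≤ C * L * r ^ β := by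
  obtain ⟨C, hC, H⟩ := exists_isPolyFun_of_mixedDiffBound n s
  refine ⟨C * (2 ^ (s + 1) * ((s : ℝ) + 1) ^ β), by positivity, fun g L hg hL hgL x₀ r hr => ?_⟩
  have hb : MixedDiffBound (s + 1) (2 ^ (s + 1) * (L * (((s : ℝ) + 1) * r) ^ β))
      (fun y => g (x₀ + r • WithLp.toLp 2 y)) := by
    intro i u hu y
    have heq : mixedDiff (s + 1) (fun j => Pi.single (i j) (u j))
        (fun y => g (x₀ + r • WithLp.toLp 2 y)) y =
        mixedDiff (s + 1) (fun j => r • EuclideanSpace.single (i j) (u j)) g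
          (x₀ + r • WithLp.toLp 2 y) := by
      refine Finset.sum_congr rfl fun S _ => ?_
      dsimp only
      rw [WithLp.toLp_add, WithLp.toLp_sum, smul_add, Finset.smul_sum, add_assoc]
      rfl
    rw [heq]
    refine abs_mixedDiff_le hL hβ hr.le hgL (fun j => ?_) _
    rw [norm_smul, PiLp.norm_single, Real.norm_of_nonneg hr.le,
      Real.norm_of_nonneg (hu j).1]
    exact mul_le_of_le_one_right hr.le (hu j).2
  obtain ⟨q, hq, hgq⟩ := H _ _ (by fun_prop) hb
  obtain ⟨Q, hQ, hqQ⟩ : IsPolyFun s (fun z => q (fun i => r⁻¹ * (z i - x₀ i))) :=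
    hq.comp fun i => ((IsPolyFun.coord i).sub (IsPolyFun.const _)).const_mul _
  refine ⟨Q, hQ, fun x hx => ?_⟩
  have hx' : ∀ i, |r⁻¹ * (x i - x₀ i)| ≤ 1 := by
    intro i
    have h1 : ‖(x - x₀) i‖ ≤ ‖x - x₀‖ := PiLp.norm_apply_le _ i
    rw [Metric.mem_ball, dist_eq_norm] at hx
    rw [abs_mul, abs_of_pos (inv_pos.2 hr), inv_mul_le_one₀ hr]
    exact h1.trans hx.le
  have := hgq _ hx'
  have hpt : x₀ + r • WithLp.toLp 2 (fun i => r⁻¹ * (x i - x₀ i)) = x := by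
    ext i
    simp [hr.ne']
  simp only [hpt] at this
  rw [mvEval, ← hqQ]
  refine this.trans_eq ?_
  rw [Real.mul_rpow (by positivity) hr.le]
  ring

theorem le_luxNorm_indicator {n : ℕ} {p c : ℝ} {B : Set (EuclideanSpace ℝ (Fin n))}
    (hB : MeasurableSet B) (hV : 0 < (volume B).toReal)
    (hc : ∀ lam : ℝ, 0 < lam → (volume B).toReal ≤ lam + lam ^ p → c ≤ lam) :
    c ≤ luxNorm n p (B.indicator fun _ => (1 : ℝ)) := by
  set V := (volume B).toReal
  have hint : ∀ lam : ℝ, ∫ x, PhiP p (|B.indicator (fun _ => (1 : ℝ)) x| / lam) =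
      V * (lam⁻¹ / (1 + lam⁻¹ ^ (1 - p))) := by
    intro lam
    have : (fun x => PhiP p (|B.indicator (fun _ => (1 : ℝ)) x| / lam)) =
        B.indicator fun _ => lam⁻¹ / (1 + lam⁻¹ ^ (1 - p)) := by
      ext x
      by_cases hx : x ∈ B <;> simp [hx, PhiP]
    rw [this, integral_indicator_const _ hB, smul_eq_mul]
    rfl
  refine le_csInf ⟨V, hV, ?_⟩ ?_
  · rw [hint, ← mul_div_assoc, mul_inv_cancel₀ hV.ne']
    have : 0 ≤ V⁻¹ ^ (1 - p) := by positivity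
    rw [div_le_one (by positivity)]
    linarith
  · rintro lam ⟨hlam, h⟩
    refine hc lam hlam ?_
    rw [hint, ← mul_div_assoc, div_le_one (by positivity), ← div_eq_mul_inv, div_le_iff₀ hlam,
      add_mul, one_mul, Real.inv_rpow hlam.le, ← Real.rpow_neg hlam.le,
      ← Real.rpow_add_one hlam.ne'] at h
    simpa using h

theorem rpow_le_of_le_add_rpow {p lam V : ℝ} (hp : p ∈ Set.Ioo (0 : ℝ) 1) (hlam : 0 < lam)
    (hlam1 : lam ≤ 1) (hV : 0 ≤ V) (h : V ≤ lam + lam ^ p) : (V / 2) ^ (1 / p) ≤ lam := by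
  have h1 : lam ≤ lam ^ p := by
    simpa using Real.rpow_le_rpow_of_exponent_ge hlam hlam1 hp.2.le
  calc (V / 2) ^ (1 / p) ≤ (lam ^ p) ^ (1 / p) := by
        have := hp.1
        gcongr
        linarith
    _ = lam := by rw [one_div, Real.rpow_rpow_inv hlam.le hp.1.ne']

theorem luxNorm_ge_of_lt_one {n : ℕ} {p : ℝ} (hp : p ∈ Set.Ioo (0 : ℝ) 1)
    {B : Set (EuclideanSpace ℝ (Fin n))} (hB : MeasurableSet B)
    (hV : 0 < (volume B).toReal) (hV1 : (volume B).toReal < 1) :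
    ((volume B).toReal / 2) ^ (1 / p) ≤ luxNorm n p (B.indicator fun _ => (1 : ℝ)) := by
  refine le_luxNorm_indicator hB hV fun lam hlam h => ?_
  rcases le_total lam 1 with h1 | h1
  · exact rpow_le_of_le_add_rpow hp hlam h1 hV.le h
  · have hp0 := hp.1
    exact (Real.rpow_le_one (by positivity) (by linarith) (by positivity)).trans h1

theorem luxNorm_ge_of_one_le {n : ℕ} {p : ℝ} (hp : p ∈ Set.Ioo (0 : ℝ) 1)
    {B : Set (EuclideanSpace ℝ (Fin n))} (hB : MeasurableSet B)
    (hV1 : 1 ≤ (volume B).toReal) :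
    (volume B).toReal / 2 ^ (1 / p) ≤ luxNorm n p (B.indicator fun _ => (1 : ℝ)) := by
  have hp1 : 1 ≤ 1 / p := (one_le_div hp.1).2 hp.2.le
  refine le_luxNorm_indicator hB (zero_lt_one.trans_le hV1) fun lam hlam h => ?_
  set V := (volume B).toReal
  rcases le_total lam 1 with h1 | h1
  · refine le_trans ?_ (rpow_le_of_le_add_rpow hp hlam h1 (by linarith) h)
    rw [Real.div_rpow (by linarith) zero_le_two]
    gcongr
    simpa using Real.rpow_le_rpow_of_exponent_le hV1 hp1
  · have h2 : (2 : ℝ) ≤ 2 ^ (1 / p) := by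
      simpa using Real.rpow_le_rpow_of_exponent_le one_le_two hp1
    have h3 : lam ^ p ≤ lam := by
      simpa using Real.rpow_le_rpow_of_exponent_le h1 hp.2.le
    rw [div_le_iff₀ (by positivity)]
    nlinarith

/-- If `u = v - w` with `w` orthogonal to `u`, then the mean of `|u|` is at most `sup |v|`. -/
theorem setIntegral_abs_le_of_orthogonal {X : Type*} [TopologicalSpace X] [MeasurableSpace X]
    [OpensMeasurableSpace X] {μ : Measure X} [IsFiniteMeasureOnCompacts μ] {B K : Set X}
    (hB : MeasurableSet B) (hBK : B ⊆ K) (hK : IsCompact K) (hKm : MeasurableSet K)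
    {u w : X → ℝ} {δ : ℝ}
    (hu : Continuous u) (hw : Continuous w) (hδ : ∀ x ∈ B, |u x + w x| ≤ δ)
    (huw : ∫ x in B, u x * w x ∂μ = 0) :
    ∫ x in B, |u x| ∂μ ≤ δ * (μ B).toReal := by
  have hi : ∀ f : X → ℝ, Continuous f → IntegrableOn f B μ := fun f hf =>
    (hf.continuousOn.integrableOn_compact' hK hKm).mono_set hBK
  have key : ∀ η > δ, ∫ x in B, |u x| ∂μ ≤ η * (μ B).toReal := by
    intro η hη
    by_cases hne : B.Nonempty
    swap
    · simp [Set.not_nonempty_iff_eq_empty.1 hne]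
    obtain ⟨b, hb⟩ := hne
    have hη0 : 0 < η := ((abs_nonneg _).trans (hδ b hb)).trans_lt hη
    have hpt : ∀ x ∈ B, η * |u x| ≤ η ^ 2 - u x * w x := by
      intro x hx
      have h1 : u x * (u x + w x) ≤ |u x| * η :=
        (le_abs_self _).trans <| by
          rw [abs_mul]
          exact mul_le_mul_of_nonneg_left ((hδ x hx).trans hη.le) (abs_nonneg _)
      nlinarith [sq_nonneg (|u x| - η), sq_abs (u x)]
    have hle : ∫ x in B, η * |u x| ∂μ ≤ ∫ x in B, (η ^ 2 - u x * w x) ∂μ :=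
      setIntegral_mono_on (hi _ (by fun_prop)) (hi _ (by fun_prop)) hB hpt
    rw [integral_const_mul, integral_sub (hi _ continuous_const)
      (hi (fun x => u x * w x) (hu.mul hw)), huw, sub_zero,
      setIntegral_const, smul_eq_mul, measureReal_def] at hle
    refine le_of_mul_le_mul_left ?_ hη0
    linarith
  have hlim : Filter.Tendsto (fun η => η * (μ B).toReal) (nhdsWithin δ (Set.Ioi δ))
      (nhds (δ * (μ B).toReal)) :=
    (Continuous.tendsto (by fun_prop) δ).mono_left nhdsWithin_le_nhds
  exact ge_of_tendsto hlim (Filter.eventually_of_mem self_mem_nhdsWithin key)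

theorem continuous_mvEval {n : ℕ} (P : MvPolynomial (Fin n) ℝ) :
    Continuous fun x : EuclideanSpace ℝ (Fin n) => mvEval x P :=
  (MvPolynomial.continuous_eval P).comp (PiLp.continuous_ofLp 2 _)

theorem toReal_volume_ball {n : ℕ} (hn : 0 < n) (x₀ : EuclideanSpace ℝ (Fin n)) {r : ℝ}
    (hr : 0 < r) : (volume (Metric.ball x₀ r)).toReal =
      r ^ (n : ℝ) * (volume (Metric.ball (0 : EuclideanSpace ℝ (Fin n)) 1)).toReal := by
  have : Nonempty (Fin n) := ⟨⟨0, hn⟩⟩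
  rw [Measure.addHaar_ball _ _ hr.le, ENNReal.toReal_mul, ENNReal.toReal_ofReal (by positivity),
    finrank_euclideanSpace_fin, Real.rpow_natCast]

/-- Let `p ∈ (0,1)`, `α = 1/p − 1`, `s = ⌊nα⌋`. The space `Λ_{nα}(ℝⁿ)` is continuously
embedded in `L^∞(ℝⁿ) ∩ L_loc^{Φ_p}(ℝⁿ)`: for every `g ∈ Λ_{nα}` (a continuous function with
`|g| ≤ M_g` and `|D_h^{s+1} g(x)| ≤ L·|h|^{nα}`, so `‖g‖_{Λ_{nα}} ≤ M_g + L`), the sup-norm of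
`g` and both components of `‖g‖_{L_loc^{Φ_p}}` are bounded by `C(M_g + L)`. -/
theorem stmt_10 (n : ℕ) (hn : 0 < n) (p : ℝ) (hp : p ∈ Set.Ioo (0 : ℝ) 1) :
    ∃ C > (0 : ℝ), ∀ (g : EuclideanSpace ℝ (Fin n) → ℝ) (Mg L : ℝ),
      Continuous g → (∀ x, |g x| ≤ Mg) → 0 ≤ L →
      (∀ (x h : EuclideanSpace ℝ (Fin n)), h ≠ 0 →
        |iterDiff h g (⌊(n : ℝ) * (1 / p - 1)⌋₊ + 1) x| ≤
          L * ‖h‖ ^ ((n : ℝ) * (1 / p - 1))) →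
      (∀ x, |g x| ≤ C * (Mg + L)) ∧
      (∀ (x₀ : EuclideanSpace ℝ (Fin n)) (r : ℝ), 0 < r →
        (volume (Metric.ball x₀ r)).toReal < 1 →
        ∀ P : MvPolynomial (Fin n) ℝ,
          P.totalDegree ≤ ⌊(n : ℝ) * (1 / p - 1)⌋₊ →
          (∀ R : MvPolynomial (Fin n) ℝ, R.totalDegree ≤ ⌊(n : ℝ) * (1 / p - 1)⌋₊ →
            ∫ x in Metric.ball x₀ r, (g x - mvEval x P) * mvEval x R = 0) →
          ∫ x in Metric.ball x₀ r, |g x - mvEval x P| ≤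
            C * (Mg + L) * luxNorm n p ((Metric.ball x₀ r).indicator fun _ => (1 : ℝ))) ∧
      (∀ (x₀ : EuclideanSpace ℝ (Fin n)) (r : ℝ), 0 < r →
        1 ≤ (volume (Metric.ball x₀ r)).toReal →
        ∫ x in Metric.ball x₀ r, |g x| ≤
          C * (Mg + L) * luxNorm n p ((Metric.ball x₀ r).indicator fun _ => (1 : ℝ))) := by
  have hp0 := hp.1
  have hp1 : 1 ≤ 1 / p := (one_le_div hp.1).2 hp.2.le
  set β : ℝ := (n : ℝ) * (1 / p - 1)
  set s : ℕ := ⌊β⌋₊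
  have hβ : 0 ≤ β := mul_nonneg n.cast_nonneg (by linarith)
  obtain ⟨C, hC, H⟩ := exists_mvEval_approx n s hβ
  obtain ⟨ω, hω_def⟩ : ∃ ω, ω = (volume (Metric.ball (0 : EuclideanSpace ℝ (Fin n)) 1)).toReal :=
    ⟨_, rfl⟩
  have hω : 0 < ω := hω_def ▸ ENNReal.toReal_pos
    (Metric.measure_ball_pos _ _ one_pos).ne' measure_ball_lt_top.ne
  set c : ℝ := 2 ^ (1 / p)
  have hc1 : 1 ≤ c := Real.one_le_rpow one_le_two (by linarith)
  set K : ℝ := C * ω / (ω / 2) ^ (1 / p) with hK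
  have hK0 : 0 ≤ K := by positivity
  refine ⟨c + K, by positivity, fun g Mg L hg hMg hL hgL => ⟨fun x => ?_, ?_, ?_⟩⟩
  all_goals have hMg0 : 0 ≤ Mg := (abs_nonneg _).trans (hMg 0)
  · refine (hMg x).trans ?_
    nlinarith [mul_nonneg hK0 (add_nonneg hMg0 hL)]
  · intro x₀ r hr hV1 P hP horth
    have hV := toReal_volume_ball hn x₀ hr
    rw [← hω_def] at hV
    have hV0 : 0 < (volume (Metric.ball x₀ r)).toReal := by rw [hV]; positivity
    obtain ⟨Q, hQ, hgQ⟩ := H g L hg hL hgL x₀ r hr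
    have hmain := setIntegral_abs_le_of_orthogonal (μ := volume)
      (u := fun x => g x - mvEval x P) (w := fun x => mvEval x (P - Q)) measurableSet_ball
      Metric.ball_subset_closedBall (isCompact_closedBall x₀ r) measurableSet_closedBall
      (hg.sub (continuous_mvEval P)) (continuous_mvEval _)
      (fun x hx => by simpa [mvEval] using hgQ x hx)
      (horth (P - Q) ((MvPolynomial.totalDegree_sub _ _).trans (max_le hP hQ)))
    refine hmain.trans ?_
    have hlux := luxNorm_ge_of_lt_one hp measurableSet_ball hV0 hV1
    have hscale : C * L * r ^ β * (volume (Metric.ball x₀ r)).toReal =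
        K * L * ((volume (Metric.ball x₀ r)).toReal / 2) ^ (1 / p) := by
      have h1 : r ^ β * r ^ (n : ℝ) = (r ^ (n : ℝ)) ^ (1 / p) := by
        rw [← Real.rpow_add hr, ← Real.rpow_mul hr.le]
        congr 1
        ring
      rw [hV, mul_div_assoc, Real.mul_rpow (by positivity) (by positivity), ← h1, hK]
      field_simp
    rw [hscale]
    refine mul_le_mul ?_ hlux (by positivity) (by positivity)
    nlinarith [mul_nonneg hK0 hMg0, mul_nonneg (zero_le_one.trans hc1) (add_nonneg hMg0 hL)]
  · intro x₀ r hr hV1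
    have hlux := luxNorm_ge_of_one_le hp (measurableSet_ball (x := x₀) (ε := r)) hV1
    have hint : ∫ x in Metric.ball x₀ r, |g x| ≤ Mg * (volume (Metric.ball x₀ r)).toReal := by
      exact (le_abs_self _).trans <| norm_setIntegral_le_of_norm_le_const (f := fun x => |g x|)
        measure_ball_lt_top fun x _ => by simpa using hMg x
    refine hint.trans ?_
    have heq : Mg * (volume (Metric.ball x₀ r)).toReal =
        c * Mg * ((volume (Metric.ball x₀ r)).toReal / c) := by
      field_simp
    rw [heq]
    refine mul_le_mul ?_ hlux (by positivity) (by positivity)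
    nlinarith [mul_nonneg hK0 (add_nonneg hMg0 hL), mul_nonneg (zero_le_one.trans hc1) hL]
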